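/- Let n ≤ d be positive integers, let μ be a positive finite Radon measure on ℝ^d, and let x ∈ ℝ^d satisfy θ^{n,*}_μ(x) < ∞. If the continuous square function Sμ(x) = (∫₀^∞ |R^n_{t,2t}μ(x)|² dt/t)^{1/2} is finite, then the discrete square function S̃μ(x) = (Σ_{j∈ℤ} |R^j μ(x)|²)^{1/2} is finite. -/

import Mathlib

open MeasureTheory Metric Set
open scoped ENNReal NNReal

noncomputable section

/-- The `s`-Riesz kernel in `ℝ^d`. -/
def rieszKernel (d : ℕ) (s : ℝ) (x y : EuclideanSpace ℝ (Fin d)) : EuclideanSpace ℝ (Fin d) :=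
  ‖x - y‖ ^ (-(s + 1)) • (x - y)

/-- Doubly truncated Riesz transform `R^s_{t,u} μ (x)`. -/
def truncRiesz (d : ℕ) (s : ℝ) (μ : Measure (EuclideanSpace ℝ (Fin d)))
    (x : EuclideanSpace ℝ (Fin d)) (t u : ℝ) : EuclideanSpace ℝ (Fin d) :=
  ∫ y in {y | t < dist x y ∧ dist x y ≤ u}, rieszKernel d s x y ∂μ

/-- The square function `Sμ(x)`, as a value in `ℝ≥0∞`. -/
def sqFn (d : ℕ) (s : ℝ) (μ : Measure (EuclideanSpace ℝ (Fin d)))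
    (x : EuclideanSpace ℝ (Fin d)) : ℝ≥0∞ :=
  (∫⁻ t in Ioi (0:ℝ), ENNReal.ofReal (‖truncRiesz d s μ x t (2*t)‖^2 / t)) ^ (1/2 : ℝ)

/-- Upper `s`-dimensional density. -/
def upperDensity (d : ℕ) (s : ℝ) (μ : Measure (EuclideanSpace ℝ (Fin d)))
    (x : EuclideanSpace ℝ (Fin d)) : ℝ≥0∞ :=
  Filter.limsup (fun r : ℝ => μ (closedBall x r) / ENNReal.ofReal (r ^ s))
    (nhdsWithin 0 (Ioi 0))

/-- Doubly truncated Riesz transform of the (signed) measure `f dμ`. -/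
def truncRieszF (d : ℕ) (s : ℝ) (μ : Measure (EuclideanSpace ℝ (Fin d)))
    (f : EuclideanSpace ℝ (Fin d) → ℝ)
    (x : EuclideanSpace ℝ (Fin d)) (t u : ℝ) : EuclideanSpace ℝ (Fin d) :=
  ∫ y in {y | t < dist x y ∧ dist x y ≤ u}, f y • rieszKernel d s x y ∂μ

/-- The square function `S(f dμ)(x)`, as a value in `ℝ≥0∞`. -/
def sqFnF (d : ℕ) (s : ℝ) (μ : Measure (EuclideanSpace ℝ (Fin d)))
    (f : EuclideanSpace ℝ (Fin d) → ℝ) (x : EuclideanSpace ℝ (Fin d)) : ℝ≥0∞ :=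
  (∫⁻ t in Ioi (0:ℝ), ENNReal.ofReal (‖truncRieszF d s μ f x t (2*t)‖^2 / t)) ^ (1/2 : ℝ)

/-- The smoothly truncated Riesz transform `R^j μ (x)` built from a bump `ψ0`. -/
def smoothTrunc (n d : ℕ) (ψ0 : EuclideanSpace ℝ (Fin d) → ℝ) (j : ℤ)
    (μ : Measure (EuclideanSpace ℝ (Fin d))) (x : EuclideanSpace ℝ (Fin d)) :
    EuclideanSpace ℝ (Fin d) :=
  ∫ y, (ψ0 ((2:ℝ) ^ j • (x - y)) - ψ0 ((2:ℝ) ^ (j + 1) • (x - y))) • rieszKernel d n x y ∂μ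

theorem aux_measF (d n : ℕ) (x : EuclideanSpace ℝ (Fin d)) :
    StronglyMeasurable (fun p : ℝ × EuclideanSpace ℝ (Fin d) =>
      ({p : ℝ × EuclideanSpace ℝ (Fin d) | p.1 < dist x p.2 ∧ dist x p.2 ≤ 2 * p.1}).indicator
        (fun p => rieszKernel d n x p.2) p) := by
  apply Measurable.stronglyMeasurable
  apply Measurable.indicator
  · unfold rieszKernel
    fun_prop
  · exact (measurableSet_lt (f := fun p : ℝ × EuclideanSpace ℝ (Fin d) => p.1) (g := fun p : ℝ × EuclideanSpace ℝ (Fin d) => dist x p.2)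
      (by fun_prop) (by fun_prop)).inter
      (measurableSet_le (f := fun p : ℝ × EuclideanSpace ℝ (Fin d) => dist x p.2) (g := fun p : ℝ × EuclideanSpace ℝ (Fin d) => 2 * p.1)
      (by fun_prop) (by fun_prop))

theorem aux_k (d n : ℕ) (μ : Measure (EuclideanSpace ℝ (Fin d)))
    (x : EuclideanSpace ℝ (Fin d)) (t : ℝ) :
    truncRiesz d n μ x t (2*t) = ∫ y,
      ({p : ℝ × EuclideanSpace ℝ (Fin d) | p.1 < dist x p.2 ∧ dist x p.2 ≤ 2 * p.1}).indicator
        (fun p => rieszKernel d n x p.2) (t, y) ∂μ := by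
  unfold truncRiesz
  rw [← integral_indicator]
  · rfl
  · exact (measurableSet_lt (f := fun p : EuclideanSpace ℝ (Fin d) => t) (g := fun p : EuclideanSpace ℝ (Fin d) => dist x p)
      (by fun_prop) (by fun_prop)).inter
      (measurableSet_le (f := fun p : EuclideanSpace ℝ (Fin d) => dist x p) (g := fun p : EuclideanSpace ℝ (Fin d) => 2 * t)
      (by fun_prop) (by fun_prop))

theorem aux_kmeas (d n : ℕ) (μ : Measure (EuclideanSpace ℝ (Fin d))) [IsFiniteMeasure μ]
    (x : EuclideanSpace ℝ (Fin d)) :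
    StronglyMeasurable (fun t : ℝ => truncRiesz d n μ x t (2*t)) := by
  simp_rw [aux_k]
  exact (aux_measF d n x).integral_prod_right

/-- one-dimensional layer-cake identity -/
theorem aux_layer (ρ : ℝ → ℝ) (hρ : ContDiff ℝ 1 ρ)
    (h0 : ∀ s, 0 ≤ ρ s) (h1 : ∀ s, ρ s ≤ 1)
    (hin : ∀ s, 0 ≤ s → s < 1/2 → ρ s = 1) (hout : ∀ s, 2 ≤ s → ρ s = 0)
    (c : ℝ) (hc : 0 < c) (r : ℝ) (hr : 0 < r) :
    ρ (c * r) - ρ (2 * c * r) =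
      ∫ t in Ico (1/(4*c)) (1/c), (Ico (r/2) r).indicator
        (fun t => - (2 * c) * deriv ρ (2 * c * t)) t := by
  have hd : Continuous (deriv ρ) := hρ.continuous_deriv le_rfl
  have e1 : ∫ t in (r/2)..r, (- (2 * c) * deriv ρ (2 * c * t)) = ρ (c * r) - ρ (2 * c * r) := by
    have := intervalIntegral.integral_eq_sub_of_hasDerivAt (a := r/2) (b := r)
      (f := fun t => - ρ (2 * c * t)) (f' := fun t => - (2 * c) * deriv ρ (2 * c * t)) ?_ ?_
    · rw [this, show 2 * c * (r/2) = c * r by ring]; ring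
    · intro t _
      have h := ((hρ.differentiable one_ne_zero) (2*c*t)).hasDerivAt.comp t
        ((hasDerivAt_id t).const_mul (2*c))
      have h2 := h.neg
      convert h2 using 1
      · rfl
      · ring
    · apply Continuous.intervalIntegrable; fun_prop
  rw [← e1, intervalIntegral.integral_of_le (by linarith), ← integral_Ico_eq_integral_Ioc]
  rw [setIntegral_indicator measurableSet_Ico]
  apply setIntegral_eq_of_subset_of_forall_sdiff_eq_zero measurableSet_Ico inter_subset_right
  rintro t ⟨⟨ht1, ht2⟩, ht3⟩
  have htpos : 0 < t := by linarith
  have hz : deriv ρ (2 * c * t) = 0 := by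
    by_cases h : t < 1 / (4*c)
    · have hlt : 2 * c * t < 1/2 := by
        rw [lt_div_iff₀ (by positivity)] at h; linarith
      have : ρ (2*c*t) = 1 := hin _ (by positivity) hlt
      apply IsLocalMax.deriv_eq_zero
      exact Filter.Eventually.of_forall fun s => by rw [this]; exact h1 s
    · have h' : 1 / c ≤ t := by
        by_contra h'
        exact ht3 ⟨⟨not_lt.1 h, not_le.1 h'⟩, ht1, ht2⟩
      have hge : 2 ≤ 2 * c * t := by
        rw [div_le_iff₀ hc] at h'; linarith
      have : ρ (2*c*t) = 0 := hout _ hge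
      apply IsLocalMin.deriv_eq_zero
      exact Filter.Eventually.of_forall fun s => by rw [this]; exact h0 s
  rw [hz, mul_zero]

theorem aux_CS (f : ℝ → ℝ≥0∞) (hf : Measurable f) (I : Set ℝ) :
    (∫⁻ t in I, f t) ^ 2 ≤ volume I * ∫⁻ t in I, f t ^ 2 := by
  have h := ENNReal.lintegral_mul_le_Lp_mul_Lq (volume.restrict I) Real.HolderConjugate.two_two
    (f := fun _ => 1) (g := f) (by fun_prop) hf.aemeasurable
  simp only [Pi.mul_apply, one_mul, ENNReal.one_rpow, lintegral_const, Measure.restrict_apply MeasurableSet.univ, univ_inter] at h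
  calc _ ≤ _ := pow_le_pow_left' h 2
    _ = _ := by
      rw [mul_pow, ← ENNReal.rpow_natCast, ← ENNReal.rpow_natCast, ← ENNReal.rpow_mul,
        ← ENNReal.rpow_mul]
      norm_num

theorem aux_rep (n d : ℕ) (ψ0 : EuclideanSpace ℝ (Fin d) → ℝ) (ρ : ℝ → ℝ) (hρ : ContDiff ℝ 1 ρ)
    (h0 : ∀ s, 0 ≤ ρ s) (h1 : ∀ s, ρ s ≤ 1)
    (hin : ∀ s, 0 ≤ s → s < 1/2 → ρ s = 1) (hout : ∀ s, 2 ≤ s → ρ s = 0)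
    (hψ : ∀ z, ψ0 z = ρ ‖z‖)
    (μ : Measure (EuclideanSpace ℝ (Fin d))) [IsFiniteMeasure μ]
    (x : EuclideanSpace ℝ (Fin d)) (j : ℤ) :
    smoothTrunc n d ψ0 j μ x = ∫ t in Ico (1/(4*(2:ℝ)^j)) (1/(2:ℝ)^j),
      (-(2 * (2:ℝ)^j) * deriv ρ (2 * (2:ℝ)^j * t)) • truncRiesz d n μ x t (2*t) := by
  have hd : Continuous (deriv ρ) := hρ.continuous_deriv le_rfl
  set c : ℝ := (2:ℝ)^j with hcdef
  have hc : 0 < c := by positivity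
  unfold smoothTrunc
  simp_rw [aux_k, ← integral_smul]
  rw [integral_integral_swap]
  · congr 1
    ext1 y
    by_cases hxy : x = y
    · subst hxy
      simp [rieszKernel, indicator]
    have hr : 0 < ‖x - y‖ := norm_pos_iff.2 (sub_ne_zero.2 hxy)
    have := aux_layer ρ hρ h0 h1 hin hout c hc _ hr
    have e : ψ0 (c • (x - y)) - ψ0 ((2:ℝ)^(j+1) • (x - y)) = ρ (c * ‖x - y‖) - ρ (2 * c * ‖x - y‖) := by
      rw [hψ, hψ, norm_smul, norm_smul, Real.norm_of_nonneg hc.le,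
        Real.norm_of_nonneg (by positivity), zpow_add_one₀ (by norm_num), mul_comm c 2]
    rw [e, this, ← integral_smul_const]
    congr 1
    ext1 t
    by_cases ht : t ∈ Ico (‖x-y‖/2) ‖x-y‖
    · have : ((t, y) : ℝ × EuclideanSpace ℝ (Fin d)) ∈ {p : ℝ × EuclideanSpace ℝ (Fin d) | p.1 < dist x p.2 ∧ dist x p.2 ≤ 2 * p.1} := by
        simp only [mem_ofPred_eq, dist_eq_norm]
        exact ⟨ht.2, by linarith [ht.1]⟩
      rw [indicator_of_mem ht, indicator_of_mem this]
    · have : ((t, y) : ℝ × EuclideanSpace ℝ (Fin d)) ∉ {p : ℝ × EuclideanSpace ℝ (Fin d) | p.1 < dist x p.2 ∧ dist x p.2 ≤ 2 * p.1} := by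
        simp only [mem_ofPred_eq, dist_eq_norm]
        rintro ⟨h1, h2⟩
        exact ht ⟨by linarith, h1⟩
      rw [indicator_of_notMem ht, indicator_of_notMem this]; simp
  · obtain ⟨M, hM⟩ := (isCompact_Icc (a := 1/(4*c)) (b := 1/c)).exists_bound_of_continuousOn
      (f := fun t => (-(2 * c) * deriv ρ (2 * c * t))) (by fun_prop)
    have hmeas := (aux_measF d n x)
    refine Integrable.of_bound (C := M * ((1/(4*c)) ^ (-(n:ℝ)))) ?_ ?_
    · apply StronglyMeasurable.aestronglyMeasurable
      have hw : StronglyMeasurable (fun p : ℝ × EuclideanSpace ℝ (Fin d) =>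
          -(2 * c) * deriv ρ (2 * c * p.1)) :=
        Continuous.stronglyMeasurable (by fun_prop)
      exact hw.smul hmeas
    · have : ∀ᵐ p ∂((volume.restrict (Ico (1/(4*c)) (1/c))).prod μ), p.1 ∈ Ico (1/(4*c)) (1/c) := by
        apply Measure.quasiMeasurePreserving_fst.ae
        exact ae_restrict_mem measurableSet_Ico
      filter_upwards [this] with p hp
      have hM1 := hM p.1 ⟨hp.1, hp.2.le⟩
      have hM0 : 0 ≤ M := (norm_nonneg _).trans hM1
      simp only [Function.uncurry]
      rw [norm_smul]
      refine mul_le_mul hM1 ?_ (norm_nonneg _) hM0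
      by_cases hpS : p ∈ {p : ℝ × EuclideanSpace ℝ (Fin d) | p.1 < dist x p.2 ∧ dist x p.2 ≤ 2 * p.1}
      · rw [indicator_of_mem hpS]
        have h4 : 0 < 1/(4*c) := by positivity
        have hr : 1/(4*c) ≤ ‖x - p.2‖ := by
          rw [← dist_eq_norm]; exact hp.1.trans hpS.1.le
        have hr0 : 0 < ‖x - p.2‖ := h4.trans_le hr
        unfold rieszKernel
        rw [norm_smul, Real.norm_of_nonneg (by positivity)]
        calc _ = ‖x - p.2‖ ^ (-(n:ℝ)) := by
              conv_lhs => rw [← Real.rpow_one ‖x - p.2‖, ← Real.rpow_mul hr0.le, ← Real.rpow_add hr0]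
              congr 1; ring
          _ ≤ _ := Real.rpow_le_rpow_of_nonpos h4 hr (by simp)
      · rw [indicator_of_notMem hpS, norm_zero]; positivity

theorem aux_bound (n d : ℕ) (ψ0 : EuclideanSpace ℝ (Fin d) → ℝ) (ρ : ℝ → ℝ) (hρ : ContDiff ℝ 1 ρ)
    (h0 : ∀ s, 0 ≤ ρ s) (h1 : ∀ s, ρ s ≤ 1)
    (hin : ∀ s, 0 ≤ s → s < 1/2 → ρ s = 1) (hout : ∀ s, 2 ≤ s → ρ s = 0)
    (hψ : ∀ z, ψ0 z = ρ ‖z‖)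
    (μ : Measure (EuclideanSpace ℝ (Fin d))) [IsFiniteMeasure μ]
    (x : EuclideanSpace ℝ (Fin d)) (M : ℝ) (hM0 : 0 ≤ M)
    (hM : ∀ s ∈ Icc (1/2 : ℝ) 2, ‖deriv ρ s‖ ≤ M) (j : ℤ) :
    ENNReal.ofReal (‖smoothTrunc n d ψ0 j μ x‖^2) ≤ ENNReal.ofReal (4 * M^2) *
      ∫⁻ t in Ico (1/(4*(2:ℝ)^j)) (1/(2:ℝ)^j),
        ENNReal.ofReal (‖truncRiesz d n μ x t (2*t)‖^2 / t) := by
  rw [aux_rep n d ψ0 ρ hρ h0 h1 hin hout hψ μ x j]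
  set c : ℝ := (2:ℝ)^j with hcdef
  have hc : 0 < c := by positivity
  set I := Ico (1/(4*c)) (1/c) with hI
  have hk := (aux_kmeas d n μ x)
  set k := fun t : ℝ => truncRiesz d n μ x t (2*t) with hkdef
  have hkm : Measurable fun t => ‖k t‖ₑ := hk.measurable.enorm
  have hvol : volume I ≤ ENNReal.ofReal (1/c) := by
    rw [hI, Real.volume_Ico]
    apply ENNReal.ofReal_le_ofReal
    have : 0 < 1/(4*c) := by positivity
    linarith
  have step1 : ‖∫ t in I, (-(2 * c) * deriv ρ (2 * c * t)) • k t‖ₑ ≤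
      ENNReal.ofReal (2 * c * M) * ∫⁻ t in I, ‖k t‖ₑ := by
    refine (enorm_integral_le_lintegral_enorm _).trans ?_
    rw [← lintegral_const_mul _ hkm]
    refine setLIntegral_mono (hkm.const_mul _) ?_
    intro t ht
    rw [enorm_smul]
    gcongr
    rw [← ofReal_norm]
    apply ENNReal.ofReal_le_ofReal
    rw [norm_mul, norm_neg, Real.norm_of_nonneg (by positivity : 0 ≤ 2 * c)]
    gcongr
    apply hM
    have h1 := ht.1
    have h2 := ht.2
    rw [div_le_iff₀ (by positivity)] at h1
    rw [lt_div_iff₀ hc] at h2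
    constructor <;> linarith
  have step2 : ENNReal.ofReal c * ∫⁻ t in I, ‖k t‖ₑ ^ 2 ≤ ∫⁻ t in I, ENNReal.ofReal (‖k t‖^2 / t) := by
    rw [← lintegral_const_mul _ (hkm.pow_const 2)]
    have hmm : Measurable fun t => ENNReal.ofReal (‖k t‖^2 / t) :=
      ((hk.measurable.norm.pow_const 2).div measurable_id).ennreal_ofReal
    refine setLIntegral_mono hmm ?_
    intro t ht
    rw [← ofReal_norm, ← ENNReal.ofReal_pow (norm_nonneg _), ← ENNReal.ofReal_mul hc.le]
    apply ENNReal.ofReal_le_ofReal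
    have htpos : 0 < t := lt_of_lt_of_le (by positivity) ht.1
    have h2 := ht.2
    rw [lt_div_iff₀ hc] at h2
    rw [le_div_iff₀ htpos]
    nlinarith [sq_nonneg ‖k t‖]
  rw [ENNReal.ofReal_pow (norm_nonneg _), ofReal_norm]
  calc _ ≤ (ENNReal.ofReal (2 * c * M) * ∫⁻ t in I, ‖k t‖ₑ) ^ 2 := pow_le_pow_left' step1 2
    _ = ENNReal.ofReal (2 * c * M) ^ 2 * (∫⁻ t in I, ‖k t‖ₑ) ^ 2 := mul_pow _ _ _
    _ ≤ ENNReal.ofReal (2 * c * M) ^ 2 * (ENNReal.ofReal (1/c) * ∫⁻ t in I, ‖k t‖ₑ ^ 2) := by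
        gcongr
        exact (aux_CS _ hkm I).trans (by gcongr)
    _ = ENNReal.ofReal (4 * M^2) * (ENNReal.ofReal c * ∫⁻ t in I, ‖k t‖ₑ ^ 2) := by
        rw [← mul_assoc, ← mul_assoc, ← ENNReal.ofReal_pow (by positivity),
          ← ENNReal.ofReal_mul (by positivity), ← ENNReal.ofReal_mul (by positivity)]
        congr 2
        field_simp
        ring
    _ ≤ _ := by gcongr

theorem aux_sum (g : ℝ → ℝ≥0∞) :
    ∑' j : ℤ, ∫⁻ t in Ico (1/(4*(2:ℝ)^j)) (1/(2:ℝ)^j), g t ≤ 2 * ∫⁻ t in Ioi (0:ℝ), g t := by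
  set A : ℤ → Set ℝ := fun j => Ico (1/(2:ℝ)^(j+1)) (1/(2:ℝ)^j) with hA
  have hdis : Pairwise (Function.onFun Disjoint A) := by
    have key : ∀ i j : ℤ, i < j → Disjoint (A i) (A j) := by
      intro i j hij
      rw [Set.disjoint_left]
      rintro t ht1 ht2
      have : (1:ℝ)/(2:ℝ)^j ≤ 1/(2:ℝ)^(i+1) := by
        apply one_div_le_one_div_of_le (by positivity)
        exact zpow_le_zpow_right₀ (by norm_num) hij
      linarith [ht1.1, ht2.2]
    intro i j hij
    rcases lt_or_gt_of_ne hij with h | h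
    · exact key i j h
    · exact (key j i h).symm
  have hs : ∑' j : ℤ, ∫⁻ t in A j, g t ≤ ∫⁻ t in Ioi (0:ℝ), g t := by
    rw [← lintegral_iUnion (fun _ => measurableSet_Ico) hdis]
    apply lintegral_mono_set
    apply iUnion_subset
    intro j t ht
    exact lt_of_lt_of_le (by positivity) ht.1
  have hs' : ∑' j : ℤ, ∫⁻ t in A (j+1), g t ≤ ∫⁻ t in Ioi (0:ℝ), g t := by
    exact ((Equiv.addRight (1:ℤ)).tsum_eq (fun j => ∫⁻ t in A j, g t)).trans_le hs
  calc _ ≤ ∑' j : ℤ, ((∫⁻ t in A j, g t) + ∫⁻ t in A (j+1), g t) := by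
        apply ENNReal.tsum_le_tsum
        intro j
        refine le_trans (lintegral_mono_set ?_) (lintegral_union_le _ _ _)
        rintro t ⟨h1, h2⟩
        by_cases h : t < 1/(2:ℝ)^(j+1)
        · right
          refine ⟨?_, h⟩
          rw [zpow_add_one₀ (by norm_num), zpow_add_one₀ (by norm_num)]
          convert h1 using 2; ring
        · left
          exact ⟨not_lt.1 h, h2⟩
    _ = _ := ENNReal.tsum_add
    _ ≤ _ := by rw [two_mul]; gcongr

theorem stmt14 (n d : ℕ) (hn : 0 < n) (hnd : n ≤ d)
    (ψ0 : EuclideanSpace ℝ (Fin d) → ℝ)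
    (hψsmooth : ContDiff ℝ (⊤ : ℕ∞) ψ0)
    (hψradial : ∀ z w : EuclideanSpace ℝ (Fin d), ‖z‖ ≤ ‖w‖ → ψ0 w ≤ ψ0 z)
    (hψ0 : ∀ z, 0 ≤ ψ0 z) (hψ1 : ∀ z, ψ0 z ≤ 1)
    (hψin : ∀ z : EuclideanSpace ℝ (Fin d), ‖z‖ < 1/2 → ψ0 z = 1)
    (hψout : ∀ z : EuclideanSpace ℝ (Fin d), 2 ≤ ‖z‖ → ψ0 z = 0)
    (μ : Measure (EuclideanSpace ℝ (Fin d))) [IsFiniteMeasure μ]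
    (x : EuclideanSpace ℝ (Fin d))
    (hdens : upperDensity d n μ x < ⊤)
    (hsq : sqFn d n μ x < ⊤) :
    Summable fun j : ℤ => ‖smoothTrunc n d ψ0 j μ x‖^2 := by
  have hd : 0 < d := by omega
  set e : EuclideanSpace ℝ (Fin d) := EuclideanSpace.single ⟨0, hd⟩ (1:ℝ) with he
  have hen : ‖e‖ = 1 := by simp [he]
  set ρ : ℝ → ℝ := fun s => ψ0 (s • e) with hρdef
  have hn' : ∀ s : ℝ, ‖s • e‖ = |s| := by intro s; rw [norm_smul, hen, mul_one, Real.norm_eq_abs]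
  have hρ : ContDiff ℝ 1 ρ := by
    have h1 : ContDiff ℝ 1 ψ0 := hψsmooth.of_le (by exact_mod_cast le_top)
    exact h1.comp (contDiff_id.smul contDiff_const)
  have hψ : ∀ z, ψ0 z = ρ ‖z‖ := by
    intro z
    have : ‖‖z‖ • e‖ = ‖z‖ := by rw [hn', abs_norm]
    exact le_antisymm (hψradial _ _ this.le) (hψradial _ _ this.ge)
  have hin : ∀ s, 0 ≤ s → s < 1/2 → ρ s = 1 := fun s h1 h2 =>
    hψin _ (by rw [hn', abs_of_nonneg h1]; exact h2)
  have hout : ∀ s, 2 ≤ s → ρ s = 0 := fun s h =>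
    hψout _ (by rw [hn']; exact h.trans (le_abs_self s))
  obtain ⟨M, hM⟩ := (isCompact_Icc (a := (1/2:ℝ)) (b := 2)).exists_bound_of_continuousOn
      (f := deriv ρ) (hρ.continuous_deriv le_rfl).continuousOn
  have hM0 : 0 ≤ M := (norm_nonneg _).trans (hM 1 (by norm_num))
  have hb := aux_bound n d ψ0 ρ hρ (fun s => hψ0 _) (fun s => hψ1 _) hin hout hψ μ x M hM0 hM
  have hfin : ∫⁻ t in Ioi (0:ℝ), ENNReal.ofReal (‖truncRiesz d n μ x t (2*t)‖^2 / t) ≠ ⊤ := by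
    intro h
    unfold sqFn at hsq
    rw [h, ENNReal.top_rpow_of_pos (by norm_num)] at hsq
    exact lt_irrefl _ hsq
  have htot : ∑' j : ℤ, ENNReal.ofReal (‖smoothTrunc n d ψ0 j μ x‖^2) ≠ ⊤ := by
    refine ne_top_of_le_ne_top ?_ (ENNReal.tsum_le_tsum hb)
    rw [ENNReal.tsum_mul_left]
    refine ENNReal.mul_ne_top ENNReal.ofReal_ne_top ?_
    exact ne_top_of_le_ne_top (ENNReal.mul_ne_top (by norm_num) hfin) (aux_sum _)
  have := ENNReal.summable_toReal htot
  refine this.congr ?_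
  intro j
  rw [ENNReal.toReal_ofReal (by positivity)]
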